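/- arXiv:1905.08621 — 2 statements merged into one kernel-verified Lean document; each statement's English description precedes it below -/
import Mathlib

section
/- Every variable gadget admits exactly two 1-roundings, both of which are strong 1-roundings: either all triangle edges are rounded up to 3 and all non-triangle edges are rounded down to 2, or all triangle edges are rounded down to 2 and all non-triangle edges are rounded up to 3. Moreover, for any two vertices u, v of the gadget, the shortest path from u to v is unique, and its rounding error is either zero or equal to the rounding error on the last edge of the path ending at v. -/
open SimpleGraph

noncomputable def wWeight {V : Type*} {G : SimpleGraph V} (w : V → V → ℝ) {u v : V}
    (p : G.Walk u v) : ℝ :=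
  (p.darts.map (fun d => w d.toProd.1 d.toProd.2)).sum

def IsShortestPath {V : Type*} {G : SimpleGraph V} (w : V → V → ℝ) {u v : V}
    (p : G.Walk u v) : Prop :=
  p.IsPath ∧ ∀ q : G.Walk u v, wWeight w p ≤ wWeight w q

def PathObliviousRounding {V : Type*} (G : SimpleGraph V) (w : V → V → ℝ) (wt : V → V → ℕ)
    (ε : ℝ) : Prop :=
  ∀ (u v : V) (p : G.Walk u v), IsShortestPath w p →
    |wWeight (fun a b => (wt a b : ℝ)) p - wWeight w p| < ε

def WeakRounding {V : Type*} (G : SimpleGraph V) (w : V → V → ℝ) (wt : V → V → ℕ)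
    (ε : ℝ) : Prop :=
  PathObliviousRounding G w wt ε ∧
  ∀ (u v : V) (p : G.Walk u v), IsShortestPath w p →
    IsShortestPath (fun a b => (wt a b : ℝ)) p

def StrongRounding {V : Type*} (G : SimpleGraph V) (w : V → V → ℝ) (wt : V → V → ℕ)
    (ε : ℝ) : Prop :=
  WeakRounding G w wt ε ∧
  ∀ (u v : V) (p : G.Walk u v), IsShortestPath (fun a b => (wt a b : ℝ)) p →
    IsShortestPath w p

/-! The variable gadget with parameter `h` and set `N ⊆ Fin h` of negated positions:
`h` triangles `Δ_0, …, Δ_{h-1}` (each with a left (`0`), right (`1`) and base (`2`) vertex),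
chained right-to-left; a pendant vertex `pend false = v_0` attached to the left vertex of
`Δ_0`; a pendant vertex `pend true = v_{h+1}` attached to the right vertex of `Δ_{h-1}`;
and for each `k ∈ N` an inverter vertex attached to the base vertex of `Δ_k`.
All edges have weight `2.5`. -/

/-- Vertices of the variable gadget. -/
abbrev VGV (h : ℕ) (N : Finset (Fin h)) : Type :=
  (Fin h × Fin 3) ⊕ (Bool ⊕ {k : Fin h // k ∈ N})

/-- The `x`-th vertex of triangle `Δ_k` (`0` = left, `1` = right, `2` = base). -/
def tri {h : ℕ} {N : Finset (Fin h)} (k : Fin h) (x : Fin 3) : VGV h N := Sum.inl (k, x)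

/-- The pendant vertices: `pend false = v_0`, `pend true = v_{h+1}`. -/
def pend {h : ℕ} {N : Finset (Fin h)} (b : Bool) : VGV h N := Sum.inr (Sum.inl b)

/-- The inverter vertex attached to the base of `Δ_k`, for `k ∈ N`. -/
def inv {h : ℕ} {N : Finset (Fin h)} (k : Fin h) (hk : k ∈ N) : VGV h N :=
  Sum.inr (Sum.inr ⟨k, hk⟩)

/-- Triangle edges. -/
def triRel {h : ℕ} {N : Finset (Fin h)} (a b : VGV h N) : Prop :=
  ∃ (k : Fin h) (x y : Fin 3), x ≠ y ∧ a = tri k x ∧ b = tri k y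

/-- Non-triangle edges: chain edges, the two pendant edges, and inverter edges. -/
def nonTriRel {h : ℕ} {N : Finset (Fin h)} (a b : VGV h N) : Prop :=
  (∃ k k' : Fin h, k'.val = k.val + 1 ∧ a = tri k 1 ∧ b = tri k' 0) ∨
  (∃ k : Fin h, k.val = 0 ∧ a = pend false ∧ b = tri k 0) ∨
  (∃ k : Fin h, k.val + 1 = h ∧ a = pend true ∧ b = tri k 1) ∨
  (∃ (k : Fin h) (hk : k ∈ N), a = inv k hk ∧ b = tri k 2)

/-- The variable gadget graph. -/
def varGadget (h : ℕ) (N : Finset (Fin h)) : SimpleGraph (VGV h N) :=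
  SimpleGraph.fromRel (fun a b => triRel a b ∨ nonTriRel a b)

/-- All edges of the variable gadget have weight `2.5`. -/
noncomputable def varW (h : ℕ) (N : Finset (Fin h)) : VGV h N → VGV h N → ℝ := fun _ _ => 2.5

/-- The rounding sending every triangle edge to `t` and every non-triangle edge to `s`. -/
def VarAssign {h : ℕ} {N : Finset (Fin h)} (wt : VGV h N → VGV h N → ℕ) (t s : ℕ) : Prop :=
  (∀ a b, triRel a b ∨ triRel b a → wt a b = t) ∧
  (∀ a b, nonTriRel a b ∨ nonTriRel b a → wt a b = s)

/-- Non-triangle adjacency: the symmetric closure of `nonTriRel`. -/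
def linkRel {h : ℕ} {N : Finset (Fin h)} (a b : VGV h N) : Prop :=
  nonTriRel a b ∨ nonTriRel b a

/-- The retraction of the gadget onto its triangle `Δ_k`. -/
def retract {h : ℕ} {N : Finset (Fin h)} (k : Fin h) : VGV h N → Fin 3
  | .inl (j, x) => if j.val = k.val then x else if j.val < k.val then 0 else 1
  | .inr (.inl b) => if b = true then 1 else 0
  | .inr (.inr j) => if j.1.val = k.val then 2 else if j.1.val < k.val then 0 else 1

section Adjacency

variable {h : ℕ} {N : Finset (Fin h)}

lemma triRel_symm {a b : VGV h N} (hab : triRel a b) : triRel b a := by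
  obtain ⟨k, x, y, hxy, ha, hb⟩ := hab
  exact ⟨k, y, x, hxy.symm, hb, ha⟩

lemma linkRel_symm {a b : VGV h N} (hab : linkRel a b) : linkRel b a := Or.symm hab

lemma triRel_tri (k : Fin h) {x y : Fin 3} (hxy : x ≠ y) :
    triRel (tri k x : VGV h N) (tri k y) :=
  ⟨k, x, y, hxy, rfl, rfl⟩

lemma retract_tri_self (k : Fin h) (x : Fin 3) : retract k (tri k x : VGV h N) = x := by
  simp [retract, tri]

lemma retract_eq_of_nonTriRel {a b : VGV h N} (hab : nonTriRel a b) (j : Fin h) :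
    retract j a = retract j b := by
  rcases hab with ⟨k, k', hk, rfl, rfl⟩ | ⟨k, hk, rfl, rfl⟩ | ⟨k, hk, rfl, rfl⟩ | ⟨k, hk, rfl, rfl⟩
  · simp only [retract, tri]
    split_ifs <;> first | rfl | omega
  · simp only [retract, tri, pend]
    split_ifs <;> first | rfl | omega | simp_all
  · simp only [retract, tri, pend]
    split_ifs <;> first | rfl | omega
  · simp only [retract, tri, inv]

lemma retract_eq_of_linkRel {a b : VGV h N} (hab : linkRel a b) (j : Fin h) :
    retract j a = retract j b :=
  hab.elim (fun H => retract_eq_of_nonTriRel H j) (fun H => (retract_eq_of_nonTriRel H j).symm)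

lemma retract_succ_eq_zero {k k' : Fin h} (hk : k'.val = k.val + 1) {v : VGV h N}
    (hv : retract k v ≠ 1) : retract k' v = 0 := by
  rcases v with ⟨j, x⟩ | b | j <;> simp only [retract] at hv ⊢ <;>
    split_ifs at hv ⊢ <;> first | rfl | omega

lemma retract_pred_eq_one {k k' : Fin h} (hk : k'.val = k.val + 1) {v : VGV h N}
    (hv : retract k' v ≠ 0) : retract k v = 1 := by
  rcases v with ⟨j, x⟩ | b | j <;> simp only [retract] at hv ⊢ <;>
    split_ifs at hv ⊢ <;> first | rfl | omega

lemma not_triRel_of_linkRel {a b : VGV h N} (hab : linkRel a b) : ¬ triRel a b := by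
  rintro ⟨k, x, y, hxy, rfl, rfl⟩
  have := retract_eq_of_linkRel hab k
  rw [retract_tri_self, retract_tri_self] at this
  exact hxy this

lemma linkRel_ne {a b : VGV h N} (hab : linkRel a b) : a ≠ b := by
  rcases hab with H | H <;>
  rcases H with ⟨k, k', hk, rfl, rfl⟩ | ⟨k, hk, rfl, rfl⟩ | ⟨k, hk, rfl, rfl⟩ | ⟨k, hk, rfl, rfl⟩ <;>
  simp [tri, pend, inv]

lemma varGadget_adj {a b : VGV h N} : (varGadget h N).Adj a b ↔ triRel a b ∨ linkRel a b := by
  simp only [varGadget, SimpleGraph.fromRel_adj]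
  constructor
  · rintro ⟨-, (H | H) | (H | H)⟩
    · exact .inl H
    · exact .inr (.inl H)
    · exact .inl (triRel_symm H)
    · exact .inr (.inr H)
  · rintro (H | H)
    · refine ⟨?_, .inl (.inl H)⟩
      obtain ⟨k, x, y, hxy, rfl, rfl⟩ := H
      simpa [tri] using hxy
    · exact ⟨linkRel_ne H, H.elim (fun H => .inl (.inr H)) (fun H => .inr (.inr H))⟩

lemma linkRel_unique {a b c : VGV h N} (hb : linkRel a b) (hc : linkRel a c) : b = c := by
  rcases hb with H | H <;> rcases hc with H' | H' <;>
  rcases H with ⟨k, k', hk, h1, rfl⟩ | ⟨k, hk, h1, rfl⟩ | ⟨k, hk, h1, rfl⟩ |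
    ⟨k, hk, h1, rfl⟩ <;>
  rcases H' with ⟨j, j', hj, h2, h3⟩ | ⟨j, hj, h2, h3⟩ | ⟨j, hj, h2, h3⟩ |
    ⟨j, hj, h2, h3⟩ <;>
  simp_all [tri, pend, inv, Fin.ext_iff] <;> omega

end Adjacency

/-- The vertices that can be reached by alternating walks starting with the edge `ab`. -/
def Beyond {h : ℕ} {N : Finset (Fin h)} (a b v : VGV h N) : Prop :=
  v ≠ a ∧ ∀ k x, a = tri k x → retract k v = retract k b

/-- A walk is alternating if triangle edges and non-triangle edges alternate along it. -/
def Alternating {h : ℕ} {N : Finset (Fin h)} {u v : VGV h N} (p : (varGadget h N).Walk u v) :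
    Prop :=
  p.darts.IsChain fun d e => (triRel d.fst d.snd ↔ ¬ triRel e.fst e.snd)

section AlternatingWalks

variable {h : ℕ} {N : Finset (Fin h)}

lemma alternating_cons_cons {a b c v : VGV h N} (hab : (varGadget h N).Adj a b)
    (hbc : (varGadget h N).Adj b c) (p : (varGadget h N).Walk c v) :
    Alternating (.cons hab (.cons hbc p)) ↔
      (triRel a b ↔ ¬ triRel b c) ∧ Alternating (.cons hbc p) := by
  simp [Alternating, List.isChain_cons_cons]

lemma alternating_nil (u : VGV h N) : Alternating (.nil : (varGadget h N).Walk u u) := by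
  simp [Alternating]

lemma alternating_single {a b : VGV h N} (hab : (varGadget h N).Adj a b) :
    Alternating (.cons hab .nil) := by
  simp [Alternating]

lemma Alternating.of_cons {a b v : VGV h N} {hab : (varGadget h N).Adj a b}
    {p : (varGadget h N).Walk b v} (hp : Alternating (.cons hab p)) : Alternating p := by
  cases p with
  | nil => exact alternating_nil _
  | cons hbc p => exact ((alternating_cons_cons hab hbc p).1 hp).2

lemma beyond_step {a b c v : VGV h N} (hab : (varGadget h N).Adj a b)
    (hbc : (varGadget h N).Adj b c) (halt : triRel a b ↔ ¬ triRel b c) (hv : Beyond b c v) :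
    Beyond a b v := by
  rw [varGadget_adj] at hab hbc
  rcases hab with hab | hab
  · have hbc := hbc.resolve_left (halt.1 hab)
    obtain ⟨k, x, y, hxy, rfl, rfl⟩ := hab
    have hy : retract k v = y := by
      rw [hv.2 k y rfl, ← retract_eq_of_linkRel hbc, retract_tri_self]
    refine ⟨?_, ?_⟩
    · rintro rfl
      rw [retract_tri_self] at hy
      exact hxy hy
    · intro k' x' hx'
      obtain ⟨rfl, rfl⟩ : k = k' ∧ x = x' := by simpa [tri] using hx'
      rw [hy, retract_tri_self]
  · have hbc : triRel b c := by
      by_contra H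
      exact not_triRel_of_linkRel hab (halt.2 H)
    obtain ⟨k, x, y, hxy, rfl, rfl⟩ := hbc
    have hy : retract k v = y := by rw [hv.2 k x rfl, retract_tri_self]
    have ha := retract_eq_of_linkRel hab k
    rw [retract_tri_self] at ha
    refine ⟨?_, ?_⟩
    · rintro rfl
      exact hxy (ha.symm.trans hy)
    · rintro k' x' rfl
      rw [← retract_eq_of_linkRel hab, retract_tri_self]
      rcases hab with H | H <;>
        rcases H with ⟨j, j', hj, h1, h2⟩ | ⟨j, hj, h1, h2⟩ | ⟨j, hj, h1, h2⟩ | ⟨j, hj, h1, h2⟩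
      all_goals simp only [tri, pend, inv, Sum.inl.injEq, Prod.mk.injEq, reduceCtorEq] at h1 h2
      · obtain ⟨rfl, rfl⟩ := h1
        obtain ⟨rfl, rfl⟩ := h2
        exact retract_pred_eq_one hj (hy ▸ hxy.symm)
      · obtain ⟨rfl, rfl⟩ := h1
        obtain ⟨rfl, rfl⟩ := h2
        exact retract_succ_eq_zero hj (hy ▸ hxy.symm)

lemma beyond_self {a b : VGV h N} (hab : (varGadget h N).Adj a b) : Beyond a b b :=
  ⟨hab.ne', fun _ _ _ => rfl⟩

lemma Alternating.beyond {a b v : VGV h N} {p : (varGadget h N).Walk b v} :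
    ∀ {hab : (varGadget h N).Adj a b}, Alternating (.cons hab p) →
      ∀ z ∈ p.support, Beyond a b z := by
  induction p generalizing a with
  | nil =>
    intro hab _ z hz
    obtain rfl : z = _ := by simpa using hz
    exact beyond_self hab
  | cons hbc p ih =>
    intro hab hp z hz
    rw [alternating_cons_cons] at hp
    rw [Walk.support_cons, List.mem_cons] at hz
    rcases hz with rfl | hz
    · exact beyond_self hab
    · exact beyond_step hab hbc hp.1 (ih hp.2 z hz)

lemma beyond_unique {a b b' v : VGV h N} (hb : (varGadget h N).Adj a b)
    (hb' : (varGadget h N).Adj a b') (hv : Beyond a b v) (hv' : Beyond a b' v) : b = b' := by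
  rw [varGadget_adj] at hb hb'
  have mixed : ∀ {c c' : VGV h N}, triRel a c → linkRel a c' → Beyond a c v → Beyond a c' v →
      False := by
    rintro c c' ⟨k, x, y, hxy, rfl, rfl⟩ hc' h1 h2
    have := (h1.2 k x rfl).symm.trans (h2.2 k x rfl)
    rw [← retract_eq_of_linkRel hc', retract_tri_self, retract_tri_self] at this
    exact hxy this.symm
  rcases hb with hb | hb <;> rcases hb' with hb' | hb'
  · obtain ⟨k, x, y, hxy, rfl, rfl⟩ := hb
    obtain ⟨k', x', y', hxy', hx', rfl⟩ := hb'
    obtain ⟨rfl, rfl⟩ : k = k' ∧ x = x' := by simpa [tri] using hx'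
    have := (hv.2 k x rfl).symm.trans (hv'.2 k x rfl)
    rw [retract_tri_self, retract_tri_self] at this
    rw [this]
  · exact (mixed hb hb' hv hv').elim
  · exact (mixed hb' hb hv' hv).elim
  · exact linkRel_unique hb hb'

lemma Alternating.isPath {u v : VGV h N} {p : (varGadget h N).Walk u v} (hp : Alternating p) :
    p.IsPath := by
  induction p with
  | nil => exact Walk.IsPath.nil
  | cons hab p ih =>
    rw [Walk.cons_isPath_iff]
    exact ⟨ih hp.of_cons, fun hmem => (hp.beyond _ hmem).1 rfl⟩

lemma Alternating.unique {u v : VGV h N} {p : (varGadget h N).Walk u v} (hp : Alternating p) :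
    ∀ q : (varGadget h N).Walk u v, Alternating q → p = q := by
  induction p with
  | nil =>
    intro q hq
    cases q with
    | nil => rfl
    | cons hab q => exact ((hq.beyond _ q.end_mem_support).1 rfl).elim
  | cons hab p ih =>
    intro q hq
    cases q with
    | nil => exact ((hp.beyond _ p.end_mem_support).1 rfl).elim
    | cons hab' q =>
      obtain rfl := beyond_unique hab hab' (hp.beyond _ p.end_mem_support)
        (hq.beyond _ q.end_mem_support)
      rw [ih hp.of_cons q hq.of_cons]

end AlternatingWalks

lemma wWeight_nil {V : Type*} {G : SimpleGraph V} (w : V → V → ℝ) (u : V) :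
    wWeight w (.nil : G.Walk u u) = 0 := by
  simp [wWeight]

lemma wWeight_cons {V : Type*} {G : SimpleGraph V} (w : V → V → ℝ) {a b v : V} (hab : G.Adj a b)
    (p : G.Walk b v) : wWeight w (.cons hab p) = w a b + wWeight w p := by
  simp [wWeight]

lemma wWeight_sub {V : Type*} {G : SimpleGraph V} (w w' : V → V → ℝ) {u v : V}
    (p : G.Walk u v) : wWeight w p - wWeight w' p = wWeight (fun a b => w a b - w' a b) p := by
  induction p with
  | nil => simp [wWeight_nil]
  | cons hab p ih => rw [wWeight_cons, wWeight_cons, wWeight_cons, ← ih]; ring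

lemma wWeight_mul_natCast {V : Type*} {G : SimpleGraph V} (c : ℝ) (f : V → V → ℕ) {u v : V}
    (p : G.Walk u v) : ∃ n : ℕ, wWeight (fun a b => c * (f a b : ℝ)) p = c * n := by
  induction p with
  | nil => exact ⟨0, by simp [wWeight_nil]⟩
  | @cons a b _ hab p ih =>
    obtain ⟨n, hn⟩ := ih
    exact ⟨f a b + n, by rw [wWeight_cons, hn]; push_cast; ring⟩

section ShortestPaths

variable {h : ℕ} {N : Finset (Fin h)}

lemma exists_wWeight_lt_of_not_alternating {w : VGV h N → VGV h N → ℝ} {t s : ℝ} (ht : 0 < t)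
    (hs : 0 < s) (hwt : ∀ a b, triRel a b → w a b = t) (hws : ∀ a b, linkRel a b → w a b = s)
    {u v : VGV h N} (p : (varGadget h N).Walk u v) (hp : ¬ Alternating p) :
    ∃ q : (varGadget h N).Walk u v, wWeight w q < wWeight w p := by
  induction p with
  | nil => exact (hp (alternating_nil _)).elim
  | @cons a b _ hab p ih =>
    by_cases hp' : Alternating p
    · cases p with
      | nil => exact (hp (alternating_single hab)).elim
      | @cons _ c _ hbc p =>
        rw [alternating_cons_cons, and_iff_left hp'] at hp
        simp only [wWeight_cons]
        by_cases hT : triRel a b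
        · have hT' : triRel b c := by tauto
          rw [hwt _ _ hT, hwt _ _ hT']
          obtain ⟨k, x, y, hxy, rfl, rfl⟩ := hT
          obtain ⟨k', y', z, hyz, hy', rfl⟩ := hT'
          obtain ⟨rfl, rfl⟩ : k = k' ∧ y = y' := by simpa [tri] using hy'
          by_cases hxz : x = z
          · subst hxz
            exact ⟨p, by linarith⟩
          · have hT : triRel (tri k x : VGV h N) (tri k z) := triRel_tri k hxz
            refine ⟨.cons (varGadget_adj.2 (.inl hT)) p, ?_⟩
            rw [wWeight_cons, hwt _ _ hT]
            linarith
        · have hab' := (varGadget_adj.1 hab).resolve_left hT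
          have hbc' := (varGadget_adj.1 hbc).resolve_left (by tauto)
          rw [hws _ _ hab', hws _ _ hbc']
          obtain rfl := linkRel_unique (linkRel_symm hab') hbc'
          exact ⟨p, by linarith⟩
    · obtain ⟨q, hq⟩ := ih hp'
      exact ⟨.cons hab q, by simpa [wWeight_cons] using hq⟩

lemma varGadget_preconnected (hpos : 1 ≤ h) : (varGadget h N).Preconnected := by
  have corner : ∀ (k : Fin h) (x y : Fin 3),
      (varGadget h N).Reachable (tri k x) (tri k y) := by
    intro k x y
    by_cases hxy : x = y
    · rw [hxy]
    · exact (varGadget_adj.2 (.inl (triRel_tri k hxy))).reachable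
  have left : ∀ (n : ℕ) (hn : n < h),
      (varGadget h N).Reachable (tri ⟨n, hn⟩ 0) (tri ⟨0, hpos⟩ 0) := by
    intro n
    induction n with
    | zero => intro hn; exact Reachable.refl _
    | succ n ih =>
      intro hn
      have link : linkRel (tri ⟨n + 1, hn⟩ 0 : VGV h N) (tri ⟨n, by omega⟩ 1) :=
        .inr (.inl ⟨_, _, rfl, rfl, rfl⟩)
      exact (varGadget_adj.2 (.inr link)).reachable.trans
        ((corner _ _ _).trans (ih (by omega)))
  have root : ∀ v : VGV h N, (varGadget h N).Reachable v (tri ⟨0, hpos⟩ 0) := by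
    have htri : ∀ (k : Fin h) (x : Fin 3),
        (varGadget h N).Reachable (tri k x) (tri ⟨0, hpos⟩ 0) :=
      fun k x => (corner k x 0).trans (left k.1 k.2)
    have hlink : ∀ (v : VGV h N) (k : Fin h) (x : Fin 3), nonTriRel v (tri k x) →
        (varGadget h N).Reachable v (tri ⟨0, hpos⟩ 0) :=
      fun v k x H => (varGadget_adj.2 (.inr (.inl H))).reachable.trans (htri k x)
    rintro (⟨k, x⟩ | (_ | _) | ⟨k, hk⟩)
    · exact htri k x
    · exact hlink _ ⟨0, hpos⟩ 0 (.inr (.inl ⟨_, rfl, rfl, rfl⟩))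
    · exact hlink _ ⟨h - 1, by omega⟩ 1 (.inr (.inr (.inl ⟨_, by simp; omega, rfl, rfl⟩)))
    · exact hlink _ k 2 (.inr (.inr (.inr ⟨k, hk, rfl, rfl⟩)))
  exact fun u v => (root u).trans (root v).symm

/-- If edge weights are `c` times positive naturals, constant on triangle edges and on
non-triangle edges, then there is a minimum-weight walk between any two vertices, and all such
walks are alternating. -/
lemma exists_minimal_alternating (hpos : 1 ≤ h) {c : ℝ} (hc : 0 < c)
    {f : VGV h N → VGV h N → ℕ} {t s : ℕ} (ht : 0 < t) (hs : 0 < s)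
    (hft : ∀ a b, triRel a b → f a b = t) (hfs : ∀ a b, linkRel a b → f a b = s)
    (u v : VGV h N) :
    ∃ p : (varGadget h N).Walk u v, Alternating p ∧
      ∀ q : (varGadget h N).Walk u v, wWeight (fun a b => c * (f a b : ℝ)) p ≤
        wWeight (fun a b => c * (f a b : ℝ)) q := by
  choose n hn using fun p : (varGadget h N).Walk u v => wWeight_mul_natCast c f p
  obtain ⟨p₀⟩ := varGadget_preconnected (N := N) hpos u v
  have : Nonempty ((varGadget h N).Walk u v) := ⟨p₀⟩
  have hmin (q : (varGadget h N).Walk u v) :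
      wWeight (fun a b => c * (f a b : ℝ)) (Function.argmin n) ≤
        wWeight (fun a b => c * (f a b : ℝ)) q := by
    rw [hn, hn]
    exact mul_le_mul_of_nonneg_left (by exact_mod_cast Function.argmin_le n q) hc.le
  refine ⟨Function.argmin n, ?_, hmin⟩
  by_contra hp
  obtain ⟨q, hq⟩ := exists_wWeight_lt_of_not_alternating
      (w := fun a b => c * (f a b : ℝ)) (t := c * t) (s := c * s)
    (by positivity) (by positivity) (fun a b H => by rw [hft a b H])
    (fun a b H => by rw [hfs a b H]) _ hp
  exact (hmin q).not_gt hq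

lemma isShortestPath_iff_alternating (hpos : 1 ≤ h) {c : ℝ} (hc : 0 < c)
    {f : VGV h N → VGV h N → ℕ} {t s : ℕ} (ht : 0 < t) (hs : 0 < s)
    (hft : ∀ a b, triRel a b → f a b = t) (hfs : ∀ a b, linkRel a b → f a b = s)
    {u v : VGV h N} (p : (varGadget h N).Walk u v) :
    IsShortestPath (fun a b => c * (f a b : ℝ)) p ↔ Alternating p := by
  constructor
  · rintro ⟨-, hp⟩
    by_contra halt
    obtain ⟨q, hq⟩ := exists_wWeight_lt_of_not_alternating
      (w := fun a b => c * (f a b : ℝ)) (t := c * t) (s := c * s)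
      (by positivity) (by positivity) (fun a b H => by rw [hft a b H])
      (fun a b H => by rw [hfs a b H]) _ halt
    exact (hp q).not_gt hq
  · intro hp
    obtain ⟨q, hq, hmin⟩ := exists_minimal_alternating hpos hc ht hs hft hfs u v
    obtain rfl := hp.unique q hq
    exact ⟨hp.isPath, hmin⟩

lemma isShortestPath_varW_iff (hpos : 1 ≤ h) {u v : VGV h N} (p : (varGadget h N).Walk u v) :
    IsShortestPath (varW h N) p ↔ Alternating p := by
  have hw : varW h N = fun _ _ => (2.5 : ℝ) * ((1 : ℕ) : ℝ) := by
    funext a b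
    simp [varW]
  rw [hw]
  exact isShortestPath_iff_alternating hpos (by norm_num) one_pos one_pos
    (f := fun _ _ => 1) (fun _ _ _ => rfl) (fun _ _ _ => rfl) p

lemma isShortestPath_varAssign_iff (hpos : 1 ≤ h) {wt : VGV h N → VGV h N → ℕ} {t s : ℕ}
    (ht : 0 < t) (hs : 0 < s) (hwt : VarAssign wt t s) {u v : VGV h N}
    (p : (varGadget h N).Walk u v) :
    IsShortestPath (fun a b => (wt a b : ℝ)) p ↔ Alternating p := by
  have := isShortestPath_iff_alternating hpos one_pos ht hs
    (fun a b H => hwt.1 a b (.inl H)) (fun a b H => hwt.2 a b H) p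
  simpa only [one_mul] using this

end ShortestPaths

lemma sum_map_eq_zero_or_getLast {α : Type*} (e : α → ℝ) :
    ∀ l : List α, l.IsChain (fun a b => e a + e b = 0) →
      (l.map e).sum = 0 ∨ ∃ hne : l ≠ [], (l.map e).sum = e (l.getLast hne)
  | [], _ => .inl (by simp)
  | [a], _ => .inr ⟨by simp, by simp⟩
  | a :: b :: l, hl => by
    rw [List.isChain_cons_cons] at hl
    have hsum : ((a :: b :: l).map e).sum = (l.map e).sum := by
      simp only [List.map_cons, List.sum_cons]
      linarith [hl.1]
    rw [hsum]
    rcases sum_map_eq_zero_or_getLast e l hl.2.of_cons with H | ⟨hne, H⟩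
    · exact .inl H
    · refine .inr ⟨by simp, ?_⟩
      rw [H, List.getLast_cons (by simp), List.getLast_cons hne]

section Roundings

variable {h : ℕ} {N : Finset (Fin h)}

lemma Alternating.error {wt : VGV h N → VGV h N → ℕ} {t s : ℕ} (hts : t + s = 5)
    (hwt : VarAssign wt t s) {u v : VGV h N} {p : (varGadget h N).Walk u v}
    (hp : Alternating p) :
    wWeight (fun a b => (wt a b : ℝ)) p - wWeight (varW h N) p = 0 ∨
      ∃ hne : p.darts ≠ [],
        wWeight (fun a b => (wt a b : ℝ)) p - wWeight (varW h N) p =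
          (wt (p.darts.getLast hne).toProd.1 (p.darts.getLast hne).toProd.2 : ℝ) -
            varW h N (p.darts.getLast hne).toProd.1 (p.darts.getLast hne).toProd.2 := by
  rw [wWeight_sub]
  refine sum_map_eq_zero_or_getLast
    (fun d : (varGadget h N).Dart => (wt d.toProd.1 d.toProd.2 : ℝ) -
      varW h N d.toProd.1 d.toProd.2) p.darts (hp.imp fun d e hde => ?_)
  have hts : (t : ℝ) + s = 5 := by exact_mod_cast hts
  have hd := varGadget_adj.1 d.adj
  have he := varGadget_adj.1 e.adj
  by_cases hT : triRel d.fst d.snd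
  · have he := he.resolve_left (hde.1 hT)
    rw [hwt.1 _ _ (.inl hT), hwt.2 _ _ he]
    simp only [varW]
    linarith
  · have hd := hd.resolve_left hT
    have he : triRel e.fst e.snd := by tauto
    rw [hwt.2 _ _ hd, hwt.1 _ _ (.inl he)]
    simp only [varW]
    linarith

lemma VarAssign.pathObliviousRounding (hpos : 1 ≤ h) {wt : VGV h N → VGV h N → ℕ} {t s : ℕ}
    (hts : t + s = 5) (ht : 2 ≤ t) (hs : 2 ≤ s) (hwt : VarAssign wt t s) :
    PathObliviousRounding (varGadget h N) (varW h N) wt 1 := by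
  intro u v p hp
  rcases ((isShortestPath_varW_iff hpos p).1 hp).error hts hwt with H | ⟨hne, H⟩
  · rw [H]; simp
  · rw [H]
    have ht' : (2 : ℝ) ≤ t := by exact_mod_cast ht
    have hs' : (2 : ℝ) ≤ s := by exact_mod_cast hs
    have hts' : (t : ℝ) + s = 5 := by exact_mod_cast hts
    rcases varGadget_adj.1 (p.darts.getLast hne).adj with hT | hL
    · rw [hwt.1 _ _ (.inl hT), abs_lt]
      simp only [varW]
      constructor <;> linarith
    · rw [hwt.2 _ _ hL, abs_lt]
      simp only [varW]
      constructor <;> linarith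

lemma VarAssign.strongRounding (hpos : 1 ≤ h) {wt : VGV h N → VGV h N → ℕ} {t s : ℕ}
    (hts : t + s = 5) (ht : 2 ≤ t) (hs : 2 ≤ s) (hwt : VarAssign wt t s) :
    StrongRounding (varGadget h N) (varW h N) wt 1 := by
  have key {u v : VGV h N} (p : (varGadget h N).Walk u v) :
      IsShortestPath (varW h N) p ↔ IsShortestPath (fun a b => (wt a b : ℝ)) p := by
    rw [isShortestPath_varW_iff hpos,
      isShortestPath_varAssign_iff hpos (by omega) (by omega) hwt]
  exact ⟨⟨hwt.pathObliviousRounding hpos hts ht hs, fun _ _ p => (key p).1⟩,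
    fun _ _ p => (key p).2⟩

lemma PathObliviousRounding.weight_mem (hpos : 1 ≤ h) {wt : VGV h N → VGV h N → ℕ}
    (hwt : PathObliviousRounding (varGadget h N) (varW h N) wt 1) {a b : VGV h N}
    (hab : (varGadget h N).Adj a b) : wt a b = 2 ∨ wt a b = 3 := by
  have := hwt a b (.cons hab .nil) ((isShortestPath_varW_iff hpos _).2 (alternating_single hab))
  simp only [wWeight_cons, wWeight_nil, varW, abs_lt] at this
  have h1 : (1 : ℝ) < wt a b := by linarith
  have h2 : (wt a b : ℝ) < 4 := by linarith
  norm_cast at h1 h2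
  omega

lemma PathObliviousRounding.weight_add (hpos : 1 ≤ h) {wt : VGV h N → VGV h N → ℕ}
    (hwt : PathObliviousRounding (varGadget h N) (varW h N) wt 1) {a b c : VGV h N}
    (hab : linkRel a b) (hbc : triRel b c) : wt a b + wt b c = 5 := by
  have hab' := varGadget_adj.2 (.inr hab)
  have hbc' := varGadget_adj.2 (.inl hbc)
  have halt : Alternating (.cons hab' (.cons hbc' .nil)) :=
    (alternating_cons_cons _ _ _).2
      ⟨iff_of_false (not_triRel_of_linkRel hab) (not_not.2 hbc), alternating_single _⟩
  have := hwt a c _ ((isShortestPath_varW_iff hpos _).2 halt)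
  simp only [wWeight_cons, wWeight_nil, varW, abs_lt] at this
  have h1 : (4 : ℝ) < wt a b + wt b c := by linarith
  have h2 : (wt a b + wt b c : ℝ) < 6 := by linarith
  norm_cast at h1 h2
  omega

lemma exists_linkRel_left (k : Fin h) : ∃ a : VGV h N, linkRel a (tri k 0) := by
  by_cases hk : k.val = 0
  · exact ⟨pend false, .inl (.inr (.inl ⟨k, hk, rfl, rfl⟩))⟩
  · exact ⟨tri ⟨k.val - 1, by omega⟩ 1, .inl (.inl ⟨_, k, by simp; omega, rfl, rfl⟩)⟩

lemma exists_linkRel_right (k : Fin h) : ∃ a : VGV h N, linkRel a (tri k 1) := by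
  by_cases hk : k.val + 1 = h
  · exact ⟨pend true, .inl (.inr (.inr (.inl ⟨k, hk, rfl, rfl⟩)))⟩
  · exact ⟨tri ⟨k.val + 1, by omega⟩ 0, .inr (.inl ⟨k, _, rfl, rfl, rfl⟩)⟩

lemma PathObliviousRounding.exists_varAssign (hpos : 1 ≤ h) {wt : VGV h N → VGV h N → ℕ}
    (hsymm : ∀ a b, wt a b = wt b a)
    (hwt : PathObliviousRounding (varGadget h N) (varW h N) wt 1) :
    VarAssign wt 3 2 ∨ VarAssign wt 2 3 := by
  obtain ⟨s, hs⟩ : ∃ s, s = wt (pend false) (tri ⟨0, hpos⟩ 0) := ⟨_, rfl⟩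
  have left : ∀ (n : ℕ) (hn : n < h) (a : VGV h N), linkRel a (tri ⟨n, hn⟩ 0) →
      wt a (tri ⟨n, hn⟩ 0) = s := by
    intro n
    induction n with
    | zero =>
      intro hn a ha
      have link : linkRel (pend false : VGV h N) (tri ⟨0, hn⟩ 0) :=
        .inl (.inr (.inl ⟨_, rfl, rfl, rfl⟩))
      rw [linkRel_unique (linkRel_symm ha) (linkRel_symm link), hs]
    | succ n ih =>
      intro hn a ha
      have link : linkRel (tri ⟨n, by omega⟩ 1 : VGV h N) (tri ⟨n + 1, hn⟩ 0) :=
        .inl (.inl ⟨_, _, rfl, rfl, rfl⟩)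
      rw [linkRel_unique (linkRel_symm ha) (linkRel_symm link)]
      obtain ⟨b, hb⟩ := exists_linkRel_left (N := N) ⟨n, by omega⟩
      have e0 := ih _ b hb
      have e1 := hwt.weight_add hpos hb (triRel_tri _ (y := 1) (by decide))
      have e2 := hwt.weight_add hpos (linkRel_symm link) (triRel_tri _ (y := 0) (by decide))
      rw [hsymm (tri _ 0) (tri _ 1)] at e1
      rw [hsymm (tri _ 0) (tri _ 1)] at e2
      omega
  have leftTri (k : Fin h) {x : Fin 3} (hx : 0 ≠ x) : s + wt (tri k 0) (tri k x) = 5 := by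
    obtain ⟨b, hb⟩ := exists_linkRel_left (N := N) k
    rw [← hwt.weight_add hpos hb (triRel_tri k hx), left k.1 k.2 b hb]
  have links : ∀ (a : VGV h N) (k : Fin h) (x : Fin 3), linkRel a (tri k x) →
      wt a (tri k x) = s := by
    intro a k x ha
    by_cases hx : 0 = x
    · subst hx
      exact left k.1 k.2 a ha
    · have e1 := hwt.weight_add hpos ha (triRel_tri k (Ne.symm hx))
      have e2 := leftTri k hx
      rw [hsymm] at e2
      omega
  have hlink (a b : VGV h N) (hab : nonTriRel a b) : wt a b = s := by
    have hab' := hab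
    rcases hab' with ⟨k, k', hk, rfl, rfl⟩ | ⟨k, hk, rfl, rfl⟩ | ⟨k, hk, rfl, rfl⟩ |
      ⟨k, hk, rfl, rfl⟩ <;> exact links _ _ _ (.inl hab)
  have htri (a b : VGV h N) (hab : triRel a b) : s + wt a b = 5 := by
    have linked (k : Fin h) {x y : Fin 3} (hxy : x ≠ y)
        (hx : ∃ a : VGV h N, linkRel a (tri k x)) : s + wt (tri k x) (tri k y) = 5 := by
      obtain ⟨a, ha⟩ := hx
      rw [← links a k x ha]
      exact hwt.weight_add hpos ha (triRel_tri k hxy)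
    obtain ⟨k, x, y, hxy, rfl, rfl⟩ := hab
    have h0 := exists_linkRel_left (N := N) k
    have h1 := exists_linkRel_right (N := N) k
    fin_cases x
    · exact linked k hxy h0
    · exact linked k hxy h1
    · rw [hsymm]
      fin_cases y
      · exact linked k hxy.symm h0
      · exact linked k hxy.symm h1
      · exact (hxy rfl).elim
  have hassign : ∀ t, s + t = 5 → VarAssign wt t s := by
    intro t ht
    refine ⟨fun a b hab => ?_, fun a b hab => ?_⟩
    · have := htri a b (hab.elim id triRel_symm)
      omega
    · rcases hab with H | H
      · exact hlink a b H
      · rw [hsymm]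
        exact hlink b a H
  have hadj : (varGadget h N).Adj (pend false) (tri ⟨0, hpos⟩ 0) :=
    varGadget_adj.2 (.inr (.inl (.inr (.inl ⟨_, rfl, rfl, rfl⟩))))
  rcases hwt.weight_mem hpos hadj with H | H
  · obtain rfl : s = 2 := hs.trans H
    exact .inl (hassign 3 rfl)
  · obtain rfl : s = 3 := hs.trans H
    exact .inr (hassign 2 rfl)

end Roundings

/-- Every variable gadget admits exactly two `1`-roundings, both strong: either all triangle
edges are rounded up to `3` and all non-triangle edges down to `2`, or vice versa.
Moreover, for any two vertices `u, v`, the shortest path from `u` to `v` is unique, and its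
rounding error is either zero or equal to the rounding error on its last edge (the edge
ending at `v`). -/
theorem variable_gadget_roundings (h : ℕ) (hpos : 1 ≤ h) (N : Finset (Fin h)) :
    (∀ wt : VGV h N → VGV h N → ℕ, (∀ a b, wt a b = wt b a) →
      (PathObliviousRounding (varGadget h N) (varW h N) wt 1 ↔
        (VarAssign wt 3 2 ∨ VarAssign wt 2 3))) ∧
    (∀ wt : VGV h N → VGV h N → ℕ, (∀ a b, wt a b = wt b a) →
      (VarAssign wt 3 2 ∨ VarAssign wt 2 3) →
      StrongRounding (varGadget h N) (varW h N) wt 1) ∧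
    (∀ wt : VGV h N → VGV h N → ℕ, (∀ a b, wt a b = wt b a) →
      PathObliviousRounding (varGadget h N) (varW h N) wt 1 →
      ∀ u v : VGV h N, ∃ p : (varGadget h N).Walk u v,
        (IsShortestPath (varW h N) p ∧
          ∀ q : (varGadget h N).Walk u v, IsShortestPath (varW h N) q → q = p) ∧
        (wWeight (fun a b => (wt a b : ℝ)) p - wWeight (varW h N) p = 0 ∨
          ∃ hne : p.darts ≠ [],
            wWeight (fun a b => (wt a b : ℝ)) p - wWeight (varW h N) p =
              (wt (p.darts.getLast hne).toProd.1 (p.darts.getLast hne).toProd.2 : ℝ) -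
                varW h N (p.darts.getLast hne).toProd.1 (p.darts.getLast hne).toProd.2)) := by
  refine ⟨fun wt hsymm => ⟨fun hwt => hwt.exists_varAssign hpos hsymm, ?_⟩, ?_, ?_⟩
  · rintro (hwt | hwt) <;>
      exact hwt.pathObliviousRounding hpos (by norm_num) (by norm_num) (by norm_num)
  · rintro wt - (hwt | hwt) <;>
      exact hwt.strongRounding hpos (by norm_num) (by norm_num) (by norm_num)
  · intro wt hsymm hwt u v
    obtain ⟨p, hp, -⟩ := exists_minimal_alternating (N := N) hpos one_pos one_pos one_pos
      (f := fun _ _ => 1) (fun _ _ _ => rfl) (fun _ _ _ => rfl) u v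
    refine ⟨p, ⟨(isShortestPath_varW_iff hpos p).2 hp, fun q hq => ?_⟩, ?_⟩
    · exact (hp.unique q ((isShortestPath_varW_iff hpos q).1 hq)).symm
    · rcases hwt.exists_varAssign hpos hsymm with H | H
      · exact hp.error (by norm_num) H
      · exact hp.error (by norm_num) H
end

section
/- Let T'_1 and T'_2 be finite trees with nonnegative real edge weights whose only common vertex is their common root r, and let ε > 0. Suppose ω̃ is a function assigning natural numbers to the edges of T'_1 ∪ T'_2 whose restriction to T'_i is an ε-rounding of T'_i with root error range [a_i, b_i], for i = 1, 2. Then ω̃ is an ε-rounding of T'_1 ∪ T'_2 if and only if a_1 + a_2 > −ε and b_1 + b_2 < ε; and in that case the root error range of T'_1 ∪ T'_2 under ω̃ is [min(a_1, a_2), max(b_1, b_2)]. -/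
open SimpleGraph

/-- The rounding error of a walk. -/
noncomputable def errW {V : Type*} {G : SimpleGraph V} (ω : V → V → ℝ) (wt : V → V → ℕ)
    {u v : V} (p : G.Walk u v) : ℝ :=
  wWeight (fun a b => (wt a b : ℝ)) p - wWeight ω p

lemma errW_append {V : Type*} {G : SimpleGraph V} (ω : V → V → ℝ) (wt : V → V → ℕ)
    {u v w : V} (p : G.Walk u v) (q : G.Walk v w) :
    errW ω wt (p.append q) = errW ω wt p + errW ω wt q := by
  simp only [errW, wWeight, Walk.darts_append, List.map_append, List.sum_append]
  ring

lemma wWeight_reverse {V : Type*} {G : SimpleGraph V} (w : V → V → ℝ)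
    (hw : ∀ a b, w a b = w b a) {u v : V} (p : G.Walk u v) :
    wWeight w p.reverse = wWeight w p := by
  simp only [wWeight, Walk.darts_reverse, List.map_reverse, List.sum_reverse, List.map_map]
  congr 1
  exact List.map_congr_left fun d _ => hw _ _

lemma errW_reverse {V : Type*} {G : SimpleGraph V} (ω : V → V → ℝ) (wt : V → V → ℕ)
    (hω : ∀ a b, ω a b = ω b a) (hwt : ∀ a b, wt a b = wt b a) {u v : V} (p : G.Walk u v) :
    errW ω wt p.reverse = errW ω wt p := by
  rw [errW, errW, wWeight_reverse ω hω, wWeight_reverse _ fun a b => by rw [hwt a b]]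

/-- A walk that starts in `B` and avoids the only common vertex of `A` and `B` stays in `B`. -/
lemma support_subset_of_notMem {V : Type*} {G : SimpleGraph V} {r : V} {A B : Set V}
    (hinter : A ∩ B = {r})
    (hedges : ∀ x y, G.Adj x y → (x ∈ A ∧ y ∈ A) ∨ (x ∈ B ∧ y ∈ B))
    {u v : V} (p : G.Walk u v) (hu : u ∈ B) (hr : r ∉ p.support) :
    ∀ x ∈ p.support, x ∈ B := by
  induction p with
  | nil => simpa using hu
  | @cons u w v h q ih =>
    simp only [Walk.support_cons, List.mem_cons, not_or] at hr
    have hw : w ∈ B := by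
      rcases hedges _ _ h with hA | hB
      · have : u ∈ A ∩ B := ⟨hA.1, hu⟩
        rw [hinter] at this
        exact absurd this.symm hr.1
      · exact hB.2
    simpa using ⟨hu, ih hw hr.2⟩

/-- A path that starts in `A` either stays in `A`, or consists of a path in `A` to the common
vertex `r` followed by a path in `B`. -/
lemma path_subset_or_split {V : Type*} {G : SimpleGraph V} {r : V} {A B : Set V}
    (hinter : A ∩ B = {r})
    (hedges : ∀ x y, G.Adj x y → (x ∈ A ∧ y ∈ A) ∨ (x ∈ B ∧ y ∈ B))
    {u v : V} (p : G.Walk u v) (hp : p.IsPath) (hu : u ∈ A) :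
    (∀ x ∈ p.support, x ∈ A) ∨
      ∃ (q₁ : G.Walk u r) (q₂ : G.Walk r v), p = q₁.append q₂ ∧
        (∀ x ∈ q₁.support, x ∈ A) ∧ (∀ x ∈ q₂.support, x ∈ B) := by
  induction p with
  | nil => left; simpa using hu
  | @cons u w v h q ih =>
    have hq := (Walk.cons_isPath_iff h q).1 hp
    rcases hedges _ _ h with hA | hB
    · rcases ih hq.1 hA.2 with hin | ⟨q₁, q₂, rfl, h₁, h₂⟩
      · left
        simpa using ⟨hu, hin⟩
      · exact Or.inr ⟨Walk.cons h q₁, q₂, rfl, by simpa using ⟨hu, h₁⟩, h₂⟩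
    · have hur : u = r := by
        have : u ∈ A ∩ B := ⟨hu, hB.1⟩
        rwa [hinter] at this
      subst hur
      refine Or.inr ⟨Walk.nil, Walk.cons h q, rfl, by simpa using hu, ?_⟩
      simpa using ⟨hB.1, support_subset_of_notMem hinter hedges q hB.2 hq.2⟩

/-- Paths lying in two sets that share only one vertex concatenate at it to a path. -/
lemma isPath_append_of_inter {V : Type*} {G : SimpleGraph V} {r : V} {A B : Set V}
    (hinter : A ∩ B = {r}) {u v : V} (p : G.Walk u r) (q : G.Walk r v)
    (hp : p.IsPath) (hq : q.IsPath)
    (hpA : ∀ x ∈ p.support, x ∈ A) (hqB : ∀ x ∈ q.support, x ∈ B) :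
    (p.append q).IsPath := by
  have hq' := hq.support_nodup
  rw [← Walk.cons_tail_support, List.nodup_cons] at hq'
  rw [Walk.isPath_def, Walk.support_append, List.nodup_append']
  refine ⟨hp.support_nodup, hq'.2, fun x hxp hxq => ?_⟩
  have : x ∈ A ∩ B := ⟨hpA x hxp, hqB x (List.mem_of_mem_tail hxq)⟩
  rw [hinter, Set.mem_singleton_iff] at this
  exact hq'.1 (this ▸ hxq)

/-- In a finite tree, the paths from a fixed vertex have finitely many errors. -/
lemma finite_errW {V : Type*} [Finite V] {G : SimpleGraph V} (hG : G.IsTree)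
    (ω : V → V → ℝ) (wt : V → V → ℕ) (r : V) :
    {x | ∃ (v : V) (p : G.Walk r v), p.IsPath ∧ x = errW ω wt p}.Finite := by
  choose P _ hP using fun v => hG.existsUnique_path r v
  refine (Set.finite_range fun v => errW ω wt (P v)).subset ?_
  rintro x ⟨v, p, hp, rfl⟩
  exact ⟨v, congrArg (errW ω wt) (hP v p hp).symm⟩

/-- **merging.**
Let the finite tree `G` be the union of two subtrees `T'₁` (on the vertex set `A`) and
`T'₂` (on the vertex set `B`) whose only common vertex is the common root `r`, and let
`ε > 0`.  Suppose the natural-number weights `wt` restrict to an `ε`-rounding of `T'ᵢ`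
with root error range `[aᵢ, bᵢ]` for `i = 1, 2`.  Then `wt` is an `ε`-rounding of the whole
tree iff `a₁ + a₂ > −ε` and `b₁ + b₂ < ε`; and in that case the root error range of the
whole tree is `[min a₁ a₂, max b₁ b₂]`. -/
theorem merging_error_ranges {V : Type*} [Fintype V] (G : SimpleGraph V) (hG : G.IsTree)
    (ω : V → V → ℝ) (hsym : ∀ a b, ω a b = ω b a) (hnonneg : ∀ a b, 0 ≤ ω a b)
    (r : V) (A B : Set V) (hunion : A ∪ B = Set.univ) (hinter : A ∩ B = {r})
    (hedges : ∀ x y, G.Adj x y → (x ∈ A ∧ y ∈ A) ∨ (x ∈ B ∧ y ∈ B))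
    (ε : ℝ) (hε : 0 < ε)
    (wt : V → V → ℕ) (hwts : ∀ a b, wt a b = wt b a)
    (hrest1 : ∀ (v v' : V) (p : G.Walk v v'), p.IsPath → (∀ x ∈ p.support, x ∈ A) →
      |errW ω wt p| < ε)
    (hrest2 : ∀ (v v' : V) (p : G.Walk v v'), p.IsPath → (∀ x ∈ p.support, x ∈ B) →
      |errW ω wt p| < ε)
    (a₁ b₁ a₂ b₂ : ℝ)
    (ha₁ : a₁ = sInf {x | ∃ (v : V) (p : G.Walk r v), p.IsPath ∧
      (∀ y ∈ p.support, y ∈ A) ∧ x = errW ω wt p})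
    (hb₁ : b₁ = sSup {x | ∃ (v : V) (p : G.Walk r v), p.IsPath ∧
      (∀ y ∈ p.support, y ∈ A) ∧ x = errW ω wt p})
    (ha₂ : a₂ = sInf {x | ∃ (v : V) (p : G.Walk r v), p.IsPath ∧
      (∀ y ∈ p.support, y ∈ B) ∧ x = errW ω wt p})
    (hb₂ : b₂ = sSup {x | ∃ (v : V) (p : G.Walk r v), p.IsPath ∧
      (∀ y ∈ p.support, y ∈ B) ∧ x = errW ω wt p}) :
    ((∀ (v v' : V) (p : G.Walk v v'), p.IsPath → |errW ω wt p| < ε) ↔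
      (a₁ + a₂ > -ε ∧ b₁ + b₂ < ε)) ∧
    ((a₁ + a₂ > -ε ∧ b₁ + b₂ < ε) →
      sInf {x | ∃ (v : V) (p : G.Walk r v), p.IsPath ∧ x = errW ω wt p} = min a₁ a₂ ∧
      sSup {x | ∃ (v : V) (p : G.Walk r v), p.IsPath ∧ x = errW ω wt p} = max b₁ b₂) := by
  set S := {x | ∃ (v : V) (p : G.Walk r v), p.IsPath ∧ x = errW ω wt p} with hS
  set SA := {x | ∃ (v : V) (p : G.Walk r v), p.IsPath ∧
    (∀ y ∈ p.support, y ∈ A) ∧ x = errW ω wt p} with hSA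
  set SB := {x | ∃ (v : V) (p : G.Walk r v), p.IsPath ∧
    (∀ y ∈ p.support, y ∈ B) ∧ x = errW ω wt p} with hSB
  have hr : r ∈ A ∩ B := by rw [hinter]; rfl
  have finS : S.Finite := finite_errW hG ω wt r
  have subA : SA ⊆ S := fun x ⟨v, p, hp, _, hx⟩ => ⟨v, p, hp, hx⟩
  have subB : SB ⊆ S := fun x ⟨v, p, hp, _, hx⟩ => ⟨v, p, hp, hx⟩
  have finA := finS.subset subA
  have finB := finS.subset subB
  have neA : SA.Nonempty := ⟨_, r, Walk.nil, Walk.IsPath.nil, by simpa using hr.1, rfl⟩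
  have neB : SB.Nonempty := ⟨_, r, Walk.nil, Walk.IsPath.nil, by simpa using hr.2, rfl⟩
  have hSu : S = SA ∪ SB := by
    refine Set.Subset.antisymm ?_ (Set.union_subset subA subB)
    rintro x ⟨v, p, hp, rfl⟩
    rcases path_subset_or_split hinter hedges p hp hr.1 with h | ⟨q₁, q₂, rfl, -, h₂⟩
    · exact Or.inl ⟨v, p, hp, h, rfl⟩
    · obtain rfl := (Walk.isPath_iff_nil.1 hp.of_append_left).eq_nil
      exact Or.inr ⟨v, q₂, hp.of_append_right, h₂, rfl⟩
  have glue : ∀ x ∈ SA, ∀ y ∈ SB, ∃ (v v' : V) (p : G.Walk v v'), p.IsPath ∧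
      errW ω wt p = x + y := by
    rintro _ ⟨v, p, hp, hpA, rfl⟩ _ ⟨v', q, hq, hqB, rfl⟩
    exact ⟨v, v', p.reverse.append q,
      isPath_append_of_inter hinter _ _ hp.reverse hq (by simpa using hpA) hqB,
      by rw [errW_append, errW_reverse ω wt hsym hwts]⟩
  refine ⟨⟨fun H => ⟨?_, ?_⟩, ?_⟩, fun _ => ⟨?_, ?_⟩⟩
  · obtain ⟨v, v', p, hp, he⟩ := glue _ (neA.csInf_mem finA) _ (neB.csInf_mem finB)
    rw [ha₁, ha₂, ← he]
    exact (abs_lt.1 (H v v' p hp)).1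
  · obtain ⟨v, v', p, hp, he⟩ := glue _ (neA.csSup_mem finA) _ (neB.csSup_mem finB)
    rw [hb₁, hb₂, ← he]
    exact (abs_lt.1 (H v v' p hp)).2
  · rintro ⟨hlo, hhi⟩ v v' p hp
    have bound : ∀ x ∈ SA, ∀ y ∈ SB, |x + y| < ε := by
      intro x hx y hy
      have h₁ : a₁ ≤ x := ha₁ ▸ csInf_le finA.bddBelow hx
      have h₂ : a₂ ≤ y := ha₂ ▸ csInf_le finB.bddBelow hy
      have h₃ : x ≤ b₁ := hb₁ ▸ le_csSup finA.bddAbove hx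
      have h₄ : y ≤ b₂ := hb₂ ▸ le_csSup finB.bddAbove hy
      rw [abs_lt]
      constructor <;> linarith
    have hv : v ∈ A ∪ B := hunion ▸ Set.mem_univ v
    rcases hv with hv | hv
    · rcases path_subset_or_split hinter hedges p hp hv with h | ⟨q₁, q₂, rfl, h₁, h₂⟩
      · exact hrest1 v v' p hp h
      · rw [errW_append, ← errW_reverse ω wt hsym hwts q₁]
        exact bound _ ⟨v, _, hp.of_append_left.reverse, by simpa using h₁, rfl⟩
          _ ⟨v', q₂, hp.of_append_right, h₂, rfl⟩
    · rcases path_subset_or_split (Set.inter_comm A B ▸ hinter)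
        (fun x y h => (hedges x y h).symm) p hp hv with h | ⟨q₁, q₂, rfl, h₁, h₂⟩
      · exact hrest2 v v' p hp h
      · rw [errW_append, ← errW_reverse ω wt hsym hwts q₁, add_comm]
        exact bound _ ⟨v', q₂, hp.of_append_right, h₂, rfl⟩
          _ ⟨v, _, hp.of_append_left.reverse, by simpa using h₁, rfl⟩
  · rw [hSu, csInf_union finA.bddBelow neA finB.bddBelow neB, ha₁, ha₂]
  · rw [hSu, csSup_union finA.bddAbove neA finB.bddAbove neB, hb₁, hb₂]
end
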